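/- arXiv:2412.06293 — 4 statements merged into one kernel-verified Lean document; each statement's English description precedes it below -/
import Mathlib

section
/- Let f : ι → ℝ^d be a finite family of data points and let A and B be disjoint nonempty finite subsets of indices. Then the within-cluster sum of squared errors of the merged cluster satisfies SSE(A ∪ B) = SSE(A) + SSE(B) + (|A|·|B|/(|A|+|B|)) · ‖μ(A) − μ(B)‖²; in particular, the increase in SSE caused by merging A and B equals the Ward merge cost Δ(A,B). -/
open Finset

/-- The centroid of a finite cluster `C` of data points. -/
noncomputable def centroid {ι : Type*} {d : ℕ} (f : ι → EuclideanSpace ℝ (Fin d))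
    (C : Finset ι) : EuclideanSpace ℝ (Fin d) :=
  (C.card : ℝ)⁻¹ • ∑ i ∈ C, f i

/-- The within-cluster sum of squared errors of a cluster `C`. -/
noncomputable def SSE {ι : Type*} {d : ℕ} (f : ι → EuclideanSpace ℝ (Fin d))
    (C : Finset ι) : ℝ :=
  ∑ i ∈ C, ‖f i - centroid f C‖ ^ 2

/-- The Ward merge cost `Δ(A,B) = (|A|·|B|/(|A|+|B|)) · ‖μ(A) − μ(B)‖²`. -/
noncomputable def wardCost {ι : Type*} {d : ℕ} (f : ι → EuclideanSpace ℝ (Fin d))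
    (A B : Finset ι) : ℝ :=
  ((A.card : ℝ) * (B.card : ℝ) / ((A.card : ℝ) + (B.card : ℝ))) *
    ‖centroid f A - centroid f B‖ ^ 2

lemma SSE_aux {ι : Type*} {d : ℕ} (f : ι → EuclideanSpace ℝ (Fin d))
    (C : Finset ι) (hC : C.Nonempty) :
    SSE f C = ∑ i ∈ C, ‖f i‖ ^ 2 - (C.card : ℝ)⁻¹ * ‖∑ i ∈ C, f i‖ ^ 2 := by
  have hc : (C.card : ℝ) ≠ 0 := by exact_mod_cast hC.card_ne_zero
  unfold SSE
  simp only [norm_sub_sq_real, sum_add_distrib, sum_sub_distrib, ← mul_sum, ← sum_inner,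
    sum_const, nsmul_eq_mul]
  unfold _root_.centroid
  rw [inner_smul_right, real_inner_self_eq_norm_sq, norm_smul, mul_pow, Real.norm_eq_abs, sq_abs]
  field_simp
  ring

/-- Merging two disjoint nonempty clusters increases the SSE by exactly the Ward
merge cost: `SSE(A ∪ B) = SSE(A) + SSE(B) + Δ(A,B)`. -/
theorem SSE_union_eq_add_add_wardCost {ι : Type*} [DecidableEq ι] [Fintype ι] {d : ℕ}
    (f : ι → EuclideanSpace ℝ (Fin d)) (A B : Finset ι)
    (hA : A.Nonempty) (hB : B.Nonempty) (hAB : Disjoint A B) :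
    SSE f (A ∪ B) = SSE f A + SSE f B + wardCost f A B := by
  have ha : (A.card : ℝ) ≠ 0 := by exact_mod_cast hA.card_ne_zero
  have hb : (B.card : ℝ) ≠ 0 := by exact_mod_cast hB.card_ne_zero
  have hab : (A.card : ℝ) + (B.card : ℝ) ≠ 0 := by
    exact_mod_cast (Nat.add_pos_left hA.card_pos B.card).ne'
  rw [SSE_aux f _ (hA.mono subset_union_left), SSE_aux f A hA, SSE_aux f B hB,
    sum_union hAB, sum_union hAB, card_union_of_disjoint hAB]
  unfold wardCost _root_.centroid
  rw [norm_sub_sq_real, norm_add_sq_real, inner_smul_left, inner_smul_right, norm_smul, norm_smul,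
    mul_pow, mul_pow, Real.norm_eq_abs, sq_abs, Real.norm_eq_abs, sq_abs]
  simp only [conj_trivial]
  push_cast
  field_simp
  ring
end

section
/- Let f : ι → ℝ^d be a finite family of data points and let A, B, C be pairwise disjoint nonempty finite subsets of indices with sizes n_A, n_B, n_C. Then the Ward merge cost satisfies the Lance–Williams update formula Δ(A ∪ B, C) = ((n_A + n_C)·Δ(A,C) + (n_B + n_C)·Δ(B,C) − n_C·Δ(A,B)) / (n_A + n_B + n_C). -/
open Finset

/-- Lance–Williams update formula for Ward's method:
`Δ(A ∪ B, C) = ((n_A + n_C)·Δ(A,C) + (n_B + n_C)·Δ(B,C) − n_C·Δ(A,B)) / (n_A + n_B + n_C)`. -/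
theorem wardCost_union_lanceWilliams {ι : Type*} [DecidableEq ι] [Fintype ι] {d : ℕ}
    (f : ι → EuclideanSpace ℝ (Fin d)) (A B C : Finset ι)
    (hA : A.Nonempty) (hB : B.Nonempty) (hC : C.Nonempty)
    (hAB : Disjoint A B) (hAC : Disjoint A C) (hBC : Disjoint B C) :
    wardCost f (A ∪ B) C =
      (((A.card : ℝ) + (C.card : ℝ)) * wardCost f A C
        + ((B.card : ℝ) + (C.card : ℝ)) * wardCost f B C
        - (C.card : ℝ) * wardCost f A B)
      / ((A.card : ℝ) + (B.card : ℝ) + (C.card : ℝ)) := by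
  have ha : (0 : ℝ) < A.card := by exact_mod_cast hA.card_pos
  have hb : (0 : ℝ) < B.card := by exact_mod_cast hB.card_pos
  have hc : (0 : ℝ) < C.card := by exact_mod_cast hC.card_pos
  have hcard : ((A ∪ B).card : ℝ) = A.card + B.card := by
    rw [Finset.card_union_of_disjoint hAB]; push_cast; rfl
  have hsA : ∑ i ∈ A, f i = (A.card : ℝ) • centroid f A := by
    rw [_root_.centroid, smul_inv_smul₀ ha.ne']
  have hsB : ∑ i ∈ B, f i = (B.card : ℝ) • centroid f B := by
    rw [_root_.centroid, smul_inv_smul₀ hb.ne']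
  have hU : centroid f (A ∪ B) = ((A.card : ℝ) + B.card)⁻¹ •
      ((A.card : ℝ) • centroid f A + (B.card : ℝ) • centroid f B) := by
    rw [← hsA, ← hsB, ← Finset.sum_union hAB, ← hcard]; rfl
  unfold wardCost
  rw [hcard, hU]
  generalize centroid f A = x
  generalize centroid f B = y
  generalize centroid f C = z
  generalize (A.card : ℝ) = a at *
  generalize (B.card : ℝ) = b at *
  generalize (C.card : ℝ) = c at *
  have h1 : (a + b)⁻¹ • (a • x + b • y) - z
      = (a + b)⁻¹ • (a • (x - z) + b • (y - z)) := by
    have : z = (a + b)⁻¹ • ((a + b) • z) := by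
      rw [inv_smul_smul₀ (by positivity)]
    nth_rewrite 1 [this]
    rw [← smul_sub]
    congr 1
    module
  have h2 : x - y = (x - z) - (y - z) := by abel
  rw [h1, h2]
  generalize x - z = u
  generalize y - z = v
  rw [norm_smul, mul_pow, norm_add_sq_real, norm_sub_sq_real, norm_smul, norm_smul,
    real_inner_smul_left, real_inner_smul_right, Real.norm_eq_abs, Real.norm_eq_abs,
    Real.norm_eq_abs, mul_pow, mul_pow, sq_abs, sq_abs, sq_abs]
  generalize inner ℝ u v = t
  generalize ‖u‖ = p
  generalize ‖v‖ = q
  field_simp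
  ring
end

section
/- Ward's merge criterion is reducible: let f : ι → ℝ^d be a finite family of data points and let A, B, C be pairwise disjoint nonempty finite subsets of indices. If Δ(A,B) ≤ Δ(A,C) and Δ(A,B) ≤ Δ(B,C), then Δ(A ∪ B, C) ≥ min(Δ(A,C), Δ(B,C)); in particular Δ(A ∪ B, C) ≥ Δ(A,B). -/
open Finset

theorem lance_aux {d : ℕ} (p q r : EuclideanSpace ℝ (Fin d)) (a b c : ℝ)
    (ha : 0 < a) (hb : 0 < b) (hc : 0 < c) :
    (a + b + c) * (((a + b) * c / ((a + b) + c)) * ‖(a + b)⁻¹ • (a • p + b • q) - r‖ ^ 2) =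
      (a + c) * ((a * c / (a + c)) * ‖p - r‖ ^ 2) + (b + c) * ((b * c / (b + c)) * ‖q - r‖ ^ 2)
        - c * ((a * b / (a + b)) * ‖p - q‖ ^ 2) := by
  have hab : a + b ≠ 0 := by positivity
  have e1 : (a + b)⁻¹ • (a • p + b • q) - r = (a + b)⁻¹ • (a • (p - r) + b • (q - r)) := by
    have : r = (a + b)⁻¹ • ((a + b) • r) := by rw [smul_smul, inv_mul_cancel₀ hab, one_smul]
    nth_rewrite 1 [this]
    module
  have e2 : p - q = (p - r) - (q - r) := by abel
  rw [e1, e2, norm_smul, mul_pow, norm_add_sq_real, norm_sub_sq_real (p - r), norm_smul, norm_smul,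
    inner_smul_left, inner_smul_right]
  simp only [Real.norm_eq_abs, mul_pow, sq_abs, conj_trivial]
  field_simp
  ring

/-- Ward's merge criterion is reducible: if `Δ(A,B) ≤ Δ(A,C)` and `Δ(A,B) ≤ Δ(B,C)`,
then `Δ(A ∪ B, C) ≥ min(Δ(A,C), Δ(B,C))`, and in particular `Δ(A ∪ B, C) ≥ Δ(A,B)`. -/
theorem wardCost_reducible {ι : Type*} [DecidableEq ι] [Fintype ι] {d : ℕ}
    (f : ι → EuclideanSpace ℝ (Fin d)) (A B C : Finset ι)
    (hA : A.Nonempty) (hB : B.Nonempty) (hC : C.Nonempty)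
    (hAB : Disjoint A B) (hAC : Disjoint A C) (hBC : Disjoint B C)
    (h₁ : wardCost f A B ≤ wardCost f A C) (h₂ : wardCost f A B ≤ wardCost f B C) :
    min (wardCost f A C) (wardCost f B C) ≤ wardCost f (A ∪ B) C ∧
      wardCost f A B ≤ wardCost f (A ∪ B) C := by
  have ha : (0 : ℝ) < A.card := by exact_mod_cast hA.card_pos
  have hb : (0 : ℝ) < B.card := by exact_mod_cast hB.card_pos
  have hc : (0 : ℝ) < C.card := by exact_mod_cast hC.card_pos
  have key := lance_aux (_root_.centroid f A) (_root_.centroid f B) (_root_.centroid f C) _ _ _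
    ha hb hc
  have hcard : ((A ∪ B).card : ℝ) = A.card + B.card := by
    exact_mod_cast Finset.card_union_of_disjoint hAB
  have hu : _root_.centroid f (A ∪ B) = ((A.card : ℝ) + B.card)⁻¹ •
      ((A.card : ℝ) • _root_.centroid f A + (B.card : ℝ) • _root_.centroid f B) := by
    simp only [_root_.centroid]
    rw [hcard, Finset.sum_union hAB, smul_smul, smul_smul, mul_inv_cancel₀ ha.ne',
      mul_inv_cancel₀ hb.ne', one_smul, one_smul]
  have key2 : ((A.card : ℝ) + B.card + C.card) * wardCost f (A ∪ B) C =
      ((A.card : ℝ) + C.card) * wardCost f A C + ((B.card : ℝ) + C.card) * wardCost f B C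
        - C.card * wardCost f A B := by
    rw [← hu] at key
    simp only [wardCost, hcard]
    exact key
  have hm : min (wardCost f A C) (wardCost f B C) ≤ wardCost f (A ∪ B) C := by
    have m1 := min_le_left (wardCost f A C) (wardCost f B C)
    have m2 := min_le_right (wardCost f A C) (wardCost f B C)
    have m3 := le_min h₁ h₂
    generalize min (wardCost f A C) (wardCost f B C) = m at *
    refine le_of_mul_le_mul_left (a := (A.card : ℝ) + B.card + C.card) ?_ (by positivity)
    rw [key2]
    have n1 := mul_le_mul_of_nonneg_left m1 (add_pos ha hc).le
    have n2 := mul_le_mul_of_nonneg_left m2 (add_pos hb hc).le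
    have n3 := mul_le_mul_of_nonneg_left m3 hc.le
    linarith
  exact ⟨hm, (le_min h₁ h₂).trans hm⟩
end

section
/- SSE monotonicity in Ward's method (Theorem B.1): let f : ι → ℝ^d be a finite family of n data points, and let 𝒫_0, 𝒫_1, …, 𝒫_{n-1} be a sequence of partitions of the index set where 𝒫_0 consists of singletons and, for each k ≥ 1, the partition 𝒫_k is obtained from 𝒫_{k-1} by merging a pair of distinct blocks (A_k, B_k) that minimizes the Ward merge cost Δ over all pairs of distinct blocks of 𝒫_{k-1}. Then the incremental SSE of the merges is non-decreasing: Δ(A_k, B_k) ≥ Δ(A_{k-1}, B_{k-1}) for all k ≥ 2. -/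
open Finset

theorem ward_comm_aux {ι : Type*} {d : ℕ} (f : ι → EuclideanSpace ℝ (Fin d))
    (A B : Finset ι) : wardCost f A B = wardCost f B A := by
  unfold wardCost
  rw [norm_sub_rev, mul_comm (A.card : ℝ), add_comm (A.card : ℝ)]

theorem ward_norm_aux {E : Type*} [NormedAddCommGroup E] [InnerProductSpace ℝ E]
    (x y : E) (a b c m : ℝ) (ha : 0 < a) (hb : 0 < b) (hc : 0 < c)
    (hm : a * b / (a + b) * ‖x - y‖ ^ 2 = m)
    (hx : m ≤ a * c / (a + c) * ‖x‖ ^ 2) (hy : m ≤ b * c / (b + c) * ‖y‖ ^ 2) :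
    m ≤ (a + b) * c / (a + b + c) * ‖(a + b)⁻¹ • (a • x + b • y)‖ ^ 2 := by
  have h1 : ‖x - y‖ ^ 2 = ‖x‖ ^ 2 - 2 * inner ℝ x y + ‖y‖ ^ 2 := norm_sub_sq_real x y
  have h2 : ‖(a + b)⁻¹ • (a • x + b • y)‖ ^ 2
      = (a ^ 2 * ‖x‖ ^ 2 + 2 * (a * b * inner ℝ x y) + b ^ 2 * ‖y‖ ^ 2) / (a + b) ^ 2 := by
    rw [norm_smul, mul_pow, norm_add_sq_real, norm_smul, norm_smul, inner_smul_left,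
      inner_smul_right]
    simp only [Real.norm_eq_abs, mul_pow, sq_abs, RCLike.conj_to_real]
    field_simp
  have key : (a + b) * c / (a + b + c) * ‖(a + b)⁻¹ • (a • x + b • y)‖ ^ 2
      = ((a + c) * (a * c / (a + c) * ‖x‖ ^ 2) + (b + c) * (b * c / (b + c) * ‖y‖ ^ 2)
        - c * (a * b / (a + b) * ‖x - y‖ ^ 2)) / (a + b + c) := by
    rw [h2, h1]
    field_simp
    ring
  rw [key, hm, le_div_iff₀ (by positivity)]
  have e1 := mul_le_mul_of_nonneg_left hx (show 0 ≤ a + c by positivity)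
  have e2 := mul_le_mul_of_nonneg_left hy (show 0 ≤ b + c by positivity)
  linarith

theorem ward_union_aux {ι : Type*} [DecidableEq ι] {d : ℕ} (f : ι → EuclideanSpace ℝ (Fin d))
    (A B C : Finset ι) (hA : A.Nonempty) (hB : B.Nonempty) (hC : C.Nonempty)
    (hAB : Disjoint A B)
    (hx : wardCost f A B ≤ wardCost f A C) (hy : wardCost f A B ≤ wardCost f B C) :
    wardCost f A B ≤ wardCost f (A ∪ B) C := by
  have ha : (0 : ℝ) < A.card := by exact_mod_cast hA.card_pos
  have hb : (0 : ℝ) < B.card := by exact_mod_cast hB.card_pos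
  have hc : (0 : ℝ) < C.card := by exact_mod_cast hC.card_pos
  have hcard : ((A ∪ B).card : ℝ) = A.card + B.card := by
    exact_mod_cast Finset.card_union_of_disjoint hAB
  have hcen : centroid f (A ∪ B) - centroid f C
      = ((A.card : ℝ) + B.card)⁻¹ • ((A.card : ℝ) • (centroid f A - centroid f C)
        + (B.card : ℝ) • (centroid f B - centroid f C)) := by
    have hA' : (A.card : ℝ) • centroid f A = ∑ i ∈ A, f i := by
      unfold _root_.centroid; rw [smul_inv_smul₀ ha.ne']
    have hB' : (B.card : ℝ) • centroid f B = ∑ i ∈ B, f i := by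
      unfold _root_.centroid; rw [smul_inv_smul₀ hb.ne']
    have hU : centroid f (A ∪ B) = ((A.card : ℝ) + B.card)⁻¹ •
        ((A.card : ℝ) • centroid f A + (B.card : ℝ) • centroid f B) := by
      rw [hA', hB', ← Finset.sum_union hAB, ← hcard]; rfl
    have hs : ((A.card : ℝ) + B.card) ≠ 0 := by positivity
    rw [eq_inv_smul_iff₀ hs, smul_sub, hU, smul_inv_smul₀ hs]
    module
  have := ward_norm_aux (centroid f A - centroid f C) (centroid f B - centroid f C)
    A.card B.card C.card (wardCost f A B) ha hb hc
    (by rw [sub_sub_sub_cancel_right]; rfl) hx hy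
  rw [← hcen, ← hcard] at this
  exact this

/-- **SSE monotonicity in Ward's method.** For a greedy Ward merging process
`P 0, P 1, …, P (n-1)` starting from the partition of the index set into singletons,
where `P k` is obtained from `P (k-1)` by merging a pair of distinct blocks
`(A k, B k)` of minimal Ward merge cost among all pairs of distinct blocks of `P (k-1)`,
the incremental SSE of the merges is non-decreasing:
`Δ(A (k-1), B (k-1)) ≤ Δ(A k, B k)` for all `2 ≤ k ≤ n - 1`. -/
theorem ward_deltaSSE_monotone {ι : Type*} [DecidableEq ι] [Fintype ι] {d : ℕ}
    (f : ι → EuclideanSpace ℝ (Fin d))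
    (P : ℕ → Finset (Finset ι)) (A B : ℕ → Finset ι)
    (h0 : P 0 = Finset.univ.image (fun i => ({i} : Finset ι)))
    (hmem : ∀ k, 1 ≤ k → k ≤ Fintype.card ι - 1 →
      A k ∈ P (k - 1) ∧ B k ∈ P (k - 1) ∧ A k ≠ B k)
    (hstep : ∀ k, 1 ≤ k → k ≤ Fintype.card ι - 1 →
      P k = insert (A k ∪ B k) (((P (k - 1)).erase (A k)).erase (B k)))
    (hmin : ∀ k, 1 ≤ k → k ≤ Fintype.card ι - 1 →
      ∀ A' ∈ P (k - 1), ∀ B' ∈ P (k - 1), A' ≠ B' →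
        wardCost f (A k) (B k) ≤ wardCost f A' B')
    (k : ℕ) (hk₂ : 2 ≤ k) (hkn : k ≤ Fintype.card ι - 1) :
    wardCost f (A (k - 1)) (B (k - 1)) ≤ wardCost f (A k) (B k) := by
  have inv : ∀ j, j ≤ Fintype.card ι - 1 → (∀ X ∈ P j, X.Nonempty) ∧
      (∀ X ∈ P j, ∀ Y ∈ P j, X ≠ Y → Disjoint X Y) := by
    intro j
    induction j with
    | zero =>
      intro _
      rw [h0]
      constructor
      · intro X hX
        obtain ⟨i, -, rfl⟩ := Finset.mem_image.1 hX
        exact Finset.singleton_nonempty i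
      · intro X hX Y hY hne
        obtain ⟨i, -, rfl⟩ := Finset.mem_image.1 hX
        obtain ⟨i', -, rfl⟩ := Finset.mem_image.1 hY
        rw [Finset.disjoint_singleton]
        rintro rfl
        exact hne rfl
    | succ j ih =>
      intro hj
      obtain ⟨ih1, ih2⟩ := ih (by omega)
      obtain ⟨mA, mB, -⟩ := hmem (j + 1) (by omega) hj
      have hs := hstep (j + 1) (by omega) hj
      rw [Nat.add_sub_cancel] at mA mB hs
      have hd : ∀ Y ∈ ((P j).erase (A (j + 1))).erase (B (j + 1)),
          Disjoint (A (j + 1) ∪ B (j + 1)) Y := by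
        intro Y hY
        simp only [Finset.mem_erase] at hY
        rw [Finset.disjoint_union_left]
        exact ⟨ih2 _ mA _ hY.2.2 (Ne.symm hY.2.1), ih2 _ mB _ hY.2.2 (Ne.symm hY.1)⟩
      rw [hs]
      constructor
      · intro X hX
        rcases Finset.mem_insert.1 hX with rfl | hX
        · exact (ih1 _ mA).mono Finset.subset_union_left
        · exact ih1 _ (Finset.mem_of_mem_erase (Finset.mem_of_mem_erase hX))
      · intro X hX Y hY hne
        rcases Finset.mem_insert.1 hX with rfl | hX
        · rcases Finset.mem_insert.1 hY with rfl | hY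
          · exact absurd rfl hne
          · exact hd _ hY
        · rcases Finset.mem_insert.1 hY with rfl | hY
          · exact (hd _ hX).symm
          · exact ih2 _ (Finset.mem_of_mem_erase (Finset.mem_of_mem_erase hX))
              _ (Finset.mem_of_mem_erase (Finset.mem_of_mem_erase hY)) hne
  obtain ⟨j, rfl⟩ : ∃ j, k = j + 2 := ⟨k - 2, by omega⟩
  obtain ⟨i1, i2⟩ := inv j (by omega)
  obtain ⟨mA, mB, mne⟩ := hmem (j + 1) (by omega) (by omega)
  have hs := hstep (j + 1) (by omega) (by omega)
  have hm := hmin (j + 1) (by omega) (by omega)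
  obtain ⟨nA, nB, nne⟩ := hmem (j + 2) (by omega) hkn
  rw [show j + 2 - 1 = j + 1 by omega] at nA nB ⊢
  rw [Nat.add_sub_cancel] at mA mB hs hm
  rw [hs] at nA nB
  have hu : ∀ Y ∈ ((P j).erase (A (j + 1))).erase (B (j + 1)),
      wardCost f (A (j + 1)) (B (j + 1)) ≤ wardCost f (A (j + 1) ∪ B (j + 1)) Y := by
    intro Y hY
    simp only [Finset.mem_erase] at hY
    exact ward_union_aux f _ _ _ (i1 _ mA) (i1 _ mB) (i1 _ hY.2.2) (i2 _ mA _ mB mne)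
      (hm _ mA _ hY.2.2 (Ne.symm hY.2.1)) (hm _ mB _ hY.2.2 (Ne.symm hY.1))
  rcases Finset.mem_insert.1 nA with eA | nA
  · rcases Finset.mem_insert.1 nB with eB | nB
    · exact absurd (eA.trans eB.symm) nne
    · rw [eA]
      exact hu _ nB
  · rcases Finset.mem_insert.1 nB with eB | nB
    · rw [eB, ward_comm_aux f (A (j + 2))]
      exact hu _ nA
    · exact hm _ (Finset.mem_of_mem_erase (Finset.mem_of_mem_erase nA))
        _ (Finset.mem_of_mem_erase (Finset.mem_of_mem_erase nB)) nne
end
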